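/- For every real α > −1/2, one has lim_{x→∞} √(2πx)·e^{−x}·I_α(x) = 1. -/

import Mathlib

open Real Filter Set MeasureTheory

/-- The modified Bessel function of the first kind of order `α > -1/2`, defined on
`(0,∞)` by the integral representation
`I_α(x) = ((x/2)^α/(Γ(α+1/2)Γ(1/2))) ∫_{-1}^1 (1-t²)^{α-1/2} e^{-xt} dt`. -/
noncomputable def besselI (α : ℝ) (x : ℝ) : ℝ :=
  (x / 2) ^ α / (Real.Gamma (α + 1 / 2) * Real.Gamma (1 / 2)) *
    ∫ t in (-1 : ℝ)..1, (1 - t ^ 2) ^ (α - 1 / 2) * Real.exp (-x * t)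

theorem intervalIntegrable_one_sub_sq_rpow {β : ℝ} (hβ : -1 < β) :
    IntervalIntegrable (fun t : ℝ => (1 - t ^ 2) ^ β) volume 0 1 := by
  have h : IntervalIntegrable (fun t : ℝ => (1 - t) ^ β) volume 0 1 := by
    simpa using ((intervalIntegral.intervalIntegrable_rpow' (a := 0) (b := 1) hβ).comp_sub_left
      1).symm
  have hc : ContinuousOn (fun t : ℝ => (1 + t) ^ β) (uIcc 0 1) := by
    rw [uIcc_of_le zero_le_one]
    exact ContinuousOn.rpow_const (by fun_prop) fun t ht => Or.inl (by linarith [ht.1])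
  refine (h.mul_continuousOn hc).congr fun t ht => ?_
  rw [uIoc_of_le zero_le_one] at ht
  rw [← mul_rpow (by linarith [ht.2]) (by linarith [ht.1])]
  ring_nf

theorem intervalIntegrable_one_sub_sq_rpow_mul_exp {β : ℝ} (hβ : -1 < β) (x : ℝ) :
    IntervalIntegrable (fun t : ℝ => (1 - t ^ 2) ^ β * exp (-x * t)) volume 0 1 :=
  (intervalIntegrable_one_sub_sq_rpow hβ).mul_continuousOn (by fun_prop)

theorem intervalIntegrable_one_sub_sq_rpow_mul_exp_neg {β : ℝ} (hβ : -1 < β) (x : ℝ) :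
    IntervalIntegrable (fun t : ℝ => (1 - t ^ 2) ^ β * exp (-x * t)) volume (-1) 0 := by
  have h := (intervalIntegrable_one_sub_sq_rpow_mul_exp hβ (-x)).comp_sub_left 0
  simpa using h.symm

theorem abs_integral_one_sub_sq_rpow_mul_exp_le {β : ℝ} (hβ : -1 < β) {x : ℝ} (hx : 0 ≤ x) :
    |∫ t in (0 : ℝ)..1, (1 - t ^ 2) ^ β * exp (-x * t)| ≤
      ∫ t in (0 : ℝ)..1, (1 - t ^ 2) ^ β := by
  have hpos : ∀ t ∈ Icc (0 : ℝ) 1, 0 ≤ (1 - t ^ 2) ^ β := fun t ht =>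
    rpow_nonneg (by nlinarith [ht.1, ht.2]) _
  rw [abs_of_nonneg (intervalIntegral.integral_nonneg zero_le_one
    fun t ht => mul_nonneg (hpos t ht) (exp_pos _).le)]
  refine intervalIntegral.integral_mono_on zero_le_one
    (intervalIntegrable_one_sub_sq_rpow_mul_exp hβ x) (intervalIntegrable_one_sub_sq_rpow hβ)
    fun t ht => mul_le_of_le_one_right (hpos t ht) (exp_le_one_iff.2 ?_)
  nlinarith [ht.1]

theorem integral_one_sub_sq_rpow_mul_exp_eq (β : ℝ) {x : ℝ} (hx : 0 < x) :
    ∫ t in (-1 : ℝ)..0, (1 - t ^ 2) ^ β * exp (-x * t) =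
      2 ^ β * x ^ (-(β + 1)) * exp x *
        ∫ u in (0 : ℝ)..x, exp (-u) * u ^ β * (1 - u / (2 * x)) ^ β := by
  have key := intervalIntegral.integral_comp_mul_add (a := -1) (b := 0)
    (fun u => exp (-u) * u ^ β * (1 - u / (2 * x)) ^ β) hx.ne' x
  simp only [mul_neg, mul_one, neg_add_cancel, mul_zero, zero_add, smul_eq_mul] at key
  have key' : ∫ u in (0 : ℝ)..x, exp (-u) * u ^ β * (1 - u / (2 * x)) ^ β =
      x * ∫ t in (-1 : ℝ)..0,
        exp (-(x * t + x)) * (x * t + x) ^ β * (1 - (x * t + x) / (2 * x)) ^ β := by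
    rw [key]; field_simp
  rw [key', ← mul_assoc, ← intervalIntegral.integral_const_mul]
  refine intervalIntegral.integral_congr fun t ht => ?_
  rw [uIcc_of_le (by norm_num)] at ht
  have h1 : 0 ≤ 1 + t := by linarith [ht.1]
  have h2 : 0 ≤ 1 - t := by linarith [ht.2]
  have e1 : x * t + x = x * (1 + t) := by ring
  have e2 : 1 - (x * t + x) / (2 * x) = (1 - t) / 2 := by field_simp; ring
  have e3 : 1 - t ^ 2 = (1 + t) * (1 - t) := by ring
  have e4 : exp (-(x * t + x)) = exp (-x * t) * (exp x)⁻¹ := by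
    rw [← exp_neg, ← exp_add]; ring_nf
  have e5 : x ^ (-(β + 1)) = (x ^ β * x)⁻¹ := by
    rw [rpow_neg hx.le, rpow_add hx, rpow_one]
  have hxβ : 0 < x ^ β := rpow_pos_of_pos hx _
  have h2β : 0 < (2 : ℝ) ^ β := rpow_pos_of_pos two_pos _
  rw [e2, e4, e1, e3, e5, mul_rpow h1 h2, mul_rpow hx.le h1, div_rpow h2 zero_le_two]
  field_simp

theorem tendsto_integral_exp_neg_mul_rpow_mul_one_sub_rpow {β : ℝ} (hβ : -1 < β) :
    Tendsto (fun x : ℝ => ∫ u in (0 : ℝ)..x, exp (-u) * u ^ β * (1 - u / (2 * x)) ^ β)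
      atTop (nhds (Gamma (β + 1))) := by
  have hG : Gamma (β + 1) = ∫ u in Ioi (0 : ℝ), exp (-u) * u ^ β := by
    rw [Gamma_eq_integral (by linarith)]; simp
  have hint : IntegrableOn (fun u : ℝ => exp (-u) * u ^ β) (Ioi 0) := by
    simpa using GammaIntegral_convergent (s := β + 1) (by linarith)
  rw [hG]
  have hD : Tendsto (fun x : ℝ => ∫ u in Ioi (0 : ℝ),
      (Iic x).indicator (fun u => exp (-u) * u ^ β * (1 - u / (2 * x)) ^ β) u)
      atTop (nhds (∫ u in Ioi (0 : ℝ), exp (-u) * u ^ β)) := by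
    refine tendsto_integral_filter_of_dominated_convergence
      (fun u => exp (-u) * u ^ β * max 1 ((1 / 2) ^ β)) ?_ ?_ (hint.mul_const _) ?_
    · refine Eventually.of_forall fun x => (Measurable.indicator ?_
        measurableSet_Iic).aestronglyMeasurable
      fun_prop
    · filter_upwards [eventually_gt_atTop 0] with x hx
      refine (ae_restrict_iff' measurableSet_Ioi).2 (Eventually.of_forall fun u hu => ?_)
      have hu0 : 0 < u := hu
      have hp : 0 ≤ exp (-u) * u ^ β := by positivity
      by_cases hux : u ≤ x
      · have ha : 1 / 2 ≤ 1 - u / (2 * x) := by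
          have : u / (2 * x) ≤ 1 / 2 := by
            rw [div_le_div_iff₀ (by positivity) two_pos]; linarith
          linarith
        have hb : 1 - u / (2 * x) ≤ 1 := by
          have : 0 ≤ u / (2 * x) := by positivity
          linarith
        have hc : 0 ≤ (1 - u / (2 * x)) ^ β := rpow_nonneg (by linarith) _
        rw [indicator_of_mem (show u ∈ Iic x from hux), norm_of_nonneg (mul_nonneg hp hc)]
        refine mul_le_mul_of_nonneg_left ?_ hp
        rcases le_total 0 β with h | h
        · exact (rpow_le_one (by linarith) hb h).trans (le_max_left _ _)
        · exact (rpow_le_rpow_of_nonpos (by norm_num) ha h).trans (le_max_right _ _)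
      · rw [indicator_of_notMem (show u ∉ Iic x from hux), norm_zero]
        positivity
    · refine Eventually.of_forall fun u => ?_
      have h1 : Tendsto (fun x : ℝ => 1 - u / (2 * x)) atTop (nhds (1 - 0)) :=
        tendsto_const_nhds.sub
          (tendsto_const_nhds.div_atTop (tendsto_id.const_mul_atTop two_pos))
      rw [sub_zero] at h1
      have h2 := (h1.rpow_const (p := β) (Or.inl one_ne_zero)).const_mul (exp (-u) * u ^ β)
      rw [one_rpow, mul_one] at h2
      refine h2.congr' ?_
      filter_upwards [eventually_ge_atTop u] with x hx
      rw [indicator_of_mem (show u ∈ Iic x from hx)]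
  refine hD.congr' ?_
  filter_upwards [eventually_gt_atTop 0] with x hx
  rw [intervalIntegral.integral_of_le hx.le, setIntegral_indicator measurableSet_Iic,
    Ioi_inter_Iic]

/-- For `α > -1/2`, `lim_{x→∞} √(2πx) e^{-x} I_α(x) = 1`. -/
theorem tendsto_sqrt_mul_exp_neg_mul_besselI_atTop (α : ℝ) (hα : -(1 / 2) < α) :
    Filter.Tendsto (fun x => Real.sqrt (2 * Real.pi * x) * Real.exp (-x) * besselI α x)
      Filter.atTop (nhds 1) := by
  have hβ : -1 < α - 1 / 2 := by linarith
  have hΓ : 0 < Gamma (α + 1 / 2) := Gamma_pos_of_pos (by linarith)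
  have hmain := (tendsto_integral_exp_neg_mul_rpow_mul_one_sub_rpow hβ).div_const
    (Gamma (α + 1 / 2))
  rw [show α - 1 / 2 + 1 = α + 1 / 2 by ring, div_self hΓ.ne'] at hmain
  have hbdd : IsBoundedUnder (· ≤ ·) atTop (norm ∘ fun x : ℝ =>
      ∫ t in (0 : ℝ)..1, (1 - t ^ 2) ^ (α - 1 / 2) * exp (-x * t)) := by
    refine isBoundedUnder_of_eventually_le
      (a := ∫ t in (0 : ℝ)..1, (1 - t ^ 2) ^ (α - 1 / 2)) ?_
    filter_upwards [eventually_ge_atTop 0] with x hx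
    exact abs_integral_one_sub_sq_rpow_mul_exp_le hβ hx
  have hexp : Tendsto (fun x : ℝ => x ^ (α + 1 / 2) * exp (-x)) atTop (nhds 0) := by
    simpa using tendsto_rpow_mul_exp_neg_mul_atTop_nhds_zero (α + 1 / 2) 1 one_pos
  have htail := (hexp.zero_mul_isBoundedUnder_le hbdd).const_mul
    ((2 : ℝ) ^ (1 / 2 - α) / Gamma (α + 1 / 2))
  have hsum := hmain.add htail
  rw [mul_zero, add_zero] at hsum
  refine hsum.congr' ?_
  filter_upwards [eventually_gt_atTop 0] with x hx
  have hsqrt : √(2 * π * x) * ((x / 2) ^ α / (Gamma (α + 1 / 2) * Gamma (1 / 2))) =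
      2 ^ (1 / 2 - α) / Gamma (α + 1 / 2) * x ^ (α + 1 / 2) := by
    rw [Gamma_one_half_eq, sqrt_mul (by positivity), sqrt_mul zero_le_two, div_rpow hx.le
      zero_le_two, rpow_sub two_pos, rpow_add hx, ← sqrt_eq_rpow, ← sqrt_eq_rpow]
    field_simp
  have hcancel : (2 : ℝ) ^ (1 / 2 - α) * 2 ^ (α - 1 / 2) = 1 := by
    rw [← rpow_add two_pos]; simp
  have hcancel' : x ^ (α + 1 / 2) * x ^ (-(α - 1 / 2 + 1)) = 1 := by
    rw [← rpow_add hx, show α + 1 / 2 + -(α - 1 / 2 + 1) = 0 by ring, rpow_zero]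
  have hcancel'' : exp (-x) * exp x = 1 := by rw [← exp_add]; simp
  rw [besselI, ← intervalIntegral.integral_add_adjacent_intervals
    (intervalIntegrable_one_sub_sq_rpow_mul_exp_neg hβ x)
    (intervalIntegrable_one_sub_sq_rpow_mul_exp hβ x),
    integral_one_sub_sq_rpow_mul_exp_eq _ hx]
  generalize (∫ u in (0 : ℝ)..x, exp (-u) * u ^ (α - 1 / 2) *
    (1 - u / (2 * x)) ^ (α - 1 / 2)) = P
  generalize (∫ t in (0 : ℝ)..1, (1 - t ^ 2) ^ (α - 1 / 2) * exp (-x * t)) = Q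
  symm
  calc _ = √(2 * π * x) * ((x / 2) ^ α / (Gamma (α + 1 / 2) * Gamma (1 / 2))) * exp (-x) *
        (2 ^ (α - 1 / 2) * x ^ (-(α - 1 / 2 + 1)) * exp x * P + Q) := by ring
    _ = ((2 : ℝ) ^ (1 / 2 - α) * 2 ^ (α - 1 / 2)) *
          (x ^ (α + 1 / 2) * x ^ (-(α - 1 / 2 + 1))) * (exp (-x) * exp x) *
          (P / Gamma (α + 1 / 2)) +
        2 ^ (1 / 2 - α) / Gamma (α + 1 / 2) * (x ^ (α + 1 / 2) * exp (-x) * Q) := by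
      rw [hsqrt]; ring
    _ = _ := by rw [hcancel, hcancel', hcancel'']; ring
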